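/- arXiv:1102.0770 — 2 statements merged into one kernel-verified Lean document; each statement's English description precedes it below -/
import Mathlib

section
/- Let H_1, …, H_n be finite-dimensional complex Hilbert spaces, let q be a distinguished index with dim H_q = 2, and let S be a finite set of pairwise commuting self-adjoint operators on H_1 ⊗ ⋯ ⊗ H_n. Suppose the set of elements of S acting nontrivially on q admits a partition into two disjoint nonempty sets S_left and S_right such that A_{H_i} ∩ A_{H_j} ⊆ {q} for every H_i ∈ S_left and H_j ∈ S_right. Then q is separable: there exists an orthonormal basis {v₀, v₁} of H_q such that every element of S commutes with (the orthogonal projection onto ℂv₀) ⊗ (identity on the remaining factors). (Corollary 4.9: a left-right partition of the operators on a qubit implies separability.) -/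
open Matrix

/-- An operator on the system of `n` particles (with particle `i` of dimension `d i`)
acts trivially on particle `i` if it is the identity on `H_i` tensored with an operator on
the remaining factors. -/
def ActsTriviallyAt {n : ℕ} {d : Fin n → ℕ}
    (M : Matrix (∀ i, Fin (d i)) (∀ i, Fin (d i)) ℂ) (i : Fin n) : Prop :=
  ∃ N : Matrix (∀ j : {j : Fin n // j ≠ i}, Fin (d j.1))
      (∀ j : {j : Fin n // j ≠ i}, Fin (d j.1)) ℂ,
    ∀ x y, M x y = (if x i = y i then (1 : ℂ) else 0) * N (fun j => x j.1) (fun j => y j.1)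

/-- The support of an operator: the set of particles on which it acts nontrivially. -/
def supp {n : ℕ} {d : Fin n → ℕ}
    (M : Matrix (∀ i, Fin (d i)) (∀ i, Fin (d i)) ℂ) : Set (Fin n) :=
  {i | ¬ ActsTriviallyAt M i}

/-- The orthogonal projection onto `ℂv` at site `i`, tensored with the identity on all other
particles. -/
def projAt {n : ℕ} {d : Fin n → ℕ} (i : Fin n) (v : Fin (d i) → ℂ) :
    Matrix (∀ i, Fin (d i)) (∀ i, Fin (d i)) ℂ :=
  Matrix.of fun x y =>
    if Function.update x i (y i) = y then v (x i) * star (v (y i)) else 0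

/-- A particle `q` (of dimension 2) is separable for `S` if there is an orthonormal basis
`{v₀, v₁}` of `H_q` such that every element of `S` commutes with the projection onto `ℂv₀`
at site `q` (tensored with the identity elsewhere). -/
def SeparableAt {n : ℕ} {d : Fin n → ℕ}
    (S : Finset (Matrix (∀ i, Fin (d i)) (∀ i, Fin (d i)) ℂ)) (q : Fin n) : Prop :=
  ∃ v₀ v₁ : Fin (d q) → ℂ,
    star v₀ ⬝ᵥ v₀ = 1 ∧ star v₁ ⬝ᵥ v₁ = 1 ∧ star v₀ ⬝ᵥ v₁ = 0 ∧
    ∀ H ∈ S, Commute H (projAt q v₀)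

/-- The block of `M` at site `q`: the coordinates away from `q` are those of `x` (rows) and of
`y` (columns). The values `x q` and `y q` are irrelevant. -/
def siteBlock {n : ℕ} {d : Fin n → ℕ} (q : Fin n)
    (M : Matrix (∀ i, Fin (d i)) (∀ i, Fin (d i)) ℂ) (x y : ∀ i, Fin (d i)) :
    Matrix (Fin (d q)) (Fin (d q)) ℂ :=
  Matrix.of fun s t => M (Function.update x q s) (Function.update y q t)

section TwoByTwo

lemma commute_fin_two_iff (A B : Matrix (Fin 2) (Fin 2) ℂ) :
    Commute A B ↔ A 0 1 * B 1 0 = B 0 1 * A 1 0 ∧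
      (A 0 0 - A 1 1) * B 0 1 = (B 0 0 - B 1 1) * A 0 1 ∧
      (A 0 0 - A 1 1) * B 1 0 = (B 0 0 - B 1 1) * A 1 0 := by
  rw [commute_iff_eq, ← Matrix.ext_iff]
  simp only [Fin.forall_fin_two, Matrix.mul_apply, Fin.sum_univ_two]
  constructor
  · rintro ⟨⟨h1, h2⟩, h3, h4⟩
    exact ⟨by linear_combination h1, by linear_combination h2, by linear_combination -h3⟩
  · rintro ⟨h1, h2, h3⟩
    exact ⟨⟨by linear_combination h1, by linear_combination h2⟩,
      by linear_combination -h3, by linear_combination -h1⟩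

/-- The centralizer of a nonscalar `2 × 2` matrix is commutative. -/
lemma commute_of_commute_nonscalar {C A B : Matrix (Fin 2) (Fin 2) ℂ}
    (hC : ∀ c : ℂ, C ≠ c • 1) (hA : Commute C A) (hB : Commute C B) : Commute A B := by
  rw [commute_fin_two_iff] at *
  obtain ⟨a1, a2, a3⟩ := hA
  obtain ⟨b1, b2, b3⟩ := hB
  by_cases h01 : C 0 1 = 0
  · by_cases h10 : C 1 0 = 0
    · have hd : C 0 0 - C 1 1 ≠ 0 := by
        intro hd
        refine hC (C 0 0) ?_
        ext i j
        fin_cases i <;> fin_cases j <;> simp [h01, h10]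
        linear_combination -hd
      rw [h01] at a2 b2
      rw [h10] at a3 b3
      simp only [mul_zero, mul_eq_zero, hd, false_or] at a2 b2 a3 b3
      simp [a2, b2, a3, b3]
    · refine ⟨mul_left_cancel₀ h10 ?_, mul_left_cancel₀ h10 ?_, mul_left_cancel₀ h10 ?_⟩
      · linear_combination A 1 0 * b1 - B 1 0 * a1
      · linear_combination -(A 0 0 - A 1 1) * b1 + (B 0 0 - B 1 1) * a1 +
          ((A 0 0 - A 1 1) * B 1 0 - (B 0 0 - B 1 1) * A 1 0) * h01
      · linear_combination A 1 0 * b3 - B 1 0 * a3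
  · have h : (A 0 0 - A 1 1) * B 0 1 = (B 0 0 - B 1 1) * A 0 1 :=
      mul_left_cancel₀ h01 (by linear_combination A 0 1 * b2 - B 0 1 * a2)
    refine ⟨mul_left_cancel₀ h01 ?_, h, mul_left_cancel₀ h01 ?_⟩
    · linear_combination A 0 1 * b1 - B 0 1 * a1
    · linear_combination (A 0 0 - A 1 1) * b1 - (B 0 0 - B 1 1) * a1 + C 1 0 * h

/-- A matrix and its adjoint generate a nonscalar Hermitian matrix if the matrix is nonscalar. -/
lemma exists_isHermitian_nonscalar {B : Matrix (Fin 2) (Fin 2) ℂ} (hB : ∀ c : ℂ, B ≠ c • 1) :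
    ∃ C : Matrix (Fin 2) (Fin 2) ℂ, C.IsHermitian ∧ (∀ c : ℂ, C ≠ c • 1) ∧
      ∀ A, Commute A B → Commute A Bᴴ → Commute A C := by
  by_cases h : ∃ c : ℂ, B + Bᴴ = c • 1
  · obtain ⟨c, hc⟩ := h
    refine ⟨Complex.I • (B - Bᴴ), ?_, fun e he => ?_, fun A h1 h2 => (h1.sub_right h2).smul_right _⟩
    · rw [Matrix.IsHermitian, Matrix.conjTranspose_smul]
      simp [smul_sub]
      abel
    · refine hB ((c - Complex.I * e) / 2) ?_
      have h2 : B - Bᴴ = (-Complex.I * e) • (1 : Matrix (Fin 2) (Fin 2) ℂ) := by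
        rw [mul_smul, ← he, smul_smul]
        simp
      have h3 : (2 : ℂ) • B = (c - Complex.I * e) • (1 : Matrix (Fin 2) (Fin 2) ℂ) := by
        rw [sub_eq_add_neg, ← neg_mul, add_smul, ← hc, ← h2, two_smul]
        abel
      rw [div_eq_inv_mul, mul_smul, ← h3, smul_smul]
      simp
  · push Not at h
    exact ⟨B + Bᴴ, Matrix.isHermitian_add_transpose_self B, h, fun A h1 h2 => h1.add_right h2⟩

lemma exists_orthonormal_commute_of_isHermitian {C : Matrix (Fin 2) (Fin 2) ℂ}
    (hC : C.IsHermitian) (hns : ∀ c : ℂ, C ≠ c • 1) :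
    ∃ v₀ v₁ : Fin 2 → ℂ, star v₀ ⬝ᵥ v₀ = 1 ∧ star v₁ ⬝ᵥ v₁ = 1 ∧ star v₀ ⬝ᵥ v₁ = 0 ∧
      ∀ A, Commute C A → Commute A (Matrix.vecMulVec v₀ (star v₀)) := by
  have horth := orthonormal_iff_ite.mp hC.eigenvectorBasis.orthonormal
  have hdot : ∀ i j, star (⇑(hC.eigenvectorBasis i)) ⬝ᵥ ⇑(hC.eigenvectorBasis j) =
      if i = j then (1 : ℂ) else 0 := by
    intro i j
    rw [← horth i j, EuclideanSpace.inner_eq_star_dotProduct, dotProduct_comm]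
  refine ⟨⇑(hC.eigenvectorBasis 0), ⇑(hC.eigenvectorBasis 1), by simp [hdot], by simp [hdot],
    by simp [hdot], fun A hA => commute_of_commute_nonscalar hns hA ?_⟩
  have hev := hC.mulVec_eigenvectorBasis 0
  have hev' : star (⇑(hC.eigenvectorBasis 0)) ᵥ* C =
      hC.eigenvalues 0 • star (⇑(hC.eigenvectorBasis 0)) := by
    have := congrArg star hev
    rw [Matrix.star_mulVec, hC.eq] at this
    rw [this]
    ext i
    simp
  rw [commute_iff_eq, Matrix.mul_vecMulVec, Matrix.vecMulVec_mul, hev, hev',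
    Matrix.smul_vecMulVec, Matrix.vecMulVec_smul]

/-- Two elementwise commuting families of `2 × 2` matrices, each with a nonscalar member and the
second closed under adjoints, are simultaneously diagonal in an orthonormal basis. -/
lemma exists_orthonormal_commute {k : ℕ} (hk : k = 2) {L R : Set (Matrix (Fin k) (Fin k) ℂ)}
    (hLR : ∀ A ∈ L, ∀ B ∈ R, Commute A B) (hL : ∃ A ∈ L, ∀ c : ℂ, A ≠ c • 1)
    (hR : ∃ B ∈ R, ∀ c : ℂ, B ≠ c • 1) (hstar : ∀ B ∈ R, Bᴴ ∈ R) :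
    ∃ v₀ v₁ : Fin k → ℂ, star v₀ ⬝ᵥ v₀ = 1 ∧ star v₁ ⬝ᵥ v₁ = 1 ∧ star v₀ ⬝ᵥ v₁ = 0 ∧
      ∀ A, A ∈ L ∨ A ∈ R → Commute A (Matrix.vecMulVec v₀ (star v₀)) := by
  subst hk
  obtain ⟨A, hAL, hA⟩ := hL
  obtain ⟨B, hBR, hB⟩ := hR
  obtain ⟨C, hCh, hC, hCc⟩ := exists_isHermitian_nonscalar hB
  have hLC : ∀ X ∈ L, Commute X C := fun X hX => hCc X (hLR X hX B hBR) (hLR X hX _ (hstar B hBR))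
  obtain ⟨v₀, v₁, h0, h1, h01, hv⟩ := exists_orthonormal_commute_of_isHermitian hCh hC
  refine ⟨v₀, v₁, h0, h1, h01, fun X hX => hv X ?_⟩
  rcases hX with hX | hX
  · exact (hLC X hX).symm
  · exact commute_of_commute_nonscalar hA (hLC A hAL) (hLR A hAL X hX)

end TwoByTwo

section Sites

variable {n : ℕ} {d : Fin n → ℕ} {q : Fin n}
  {M M₁ M₂ : Matrix (∀ i, Fin (d i)) (∀ i, Fin (d i)) ℂ}

lemma ActsTriviallyAt.apply_eq_zero {i : Fin n} (h : ActsTriviallyAt M i)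
    {x y : ∀ i, Fin (d i)} (hxy : x i ≠ y i) : M x y = 0 := by
  obtain ⟨N, hN⟩ := h
  simp [hN, hxy]

lemma ActsTriviallyAt.apply_update {i : Fin n} (h : ActsTriviallyAt M i)
    {x y : ∀ i, Fin (d i)} (hxy : x i = y i) (s : Fin (d i)) :
    M (Function.update x i s) (Function.update y i s) = M x y := by
  obtain ⟨N, hN⟩ := h
  have hu : ∀ z : ∀ i, Fin (d i),
      (fun j : {j : Fin n // j ≠ i} => Function.update z i s j.1) =
        fun j : {j : Fin n // j ≠ i} => z j.1 :=
    fun z => funext fun j => Function.update_of_ne j.2 _ _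
  simp only [hN, hu, Function.update_self, hxy]

/-- Coordinates at which `M` acts trivially can be changed simultaneously. -/
lemma apply_piecewise_of_actsTriviallyAt (T : Finset (Fin n))
    (hT : ∀ i ∈ T, ActsTriviallyAt M i) {x y : ∀ i, Fin (d i)} (hxy : ∀ i ∈ T, x i = y i)
    (w : ∀ i, Fin (d i)) : M (T.piecewise w x) (T.piecewise w y) = M x y := by
  induction T using Finset.induction_on with
  | empty => simp
  | insert j T hj ih =>
    rw [Finset.piecewise_insert, Finset.piecewise_insert,
      (hT j (Finset.mem_insert_self j T)).apply_update]
    · exact ih (fun i hi => hT i (Finset.mem_insert_of_mem hi))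
        (fun i hi => hxy i (Finset.mem_insert_of_mem hi))
    · simpa [hj] using hxy j (Finset.mem_insert_self j T)

lemma siteBlock_congr {x x' y y' : ∀ i, Fin (d i)} (hx : ∀ i, i ≠ q → x i = x' i)
    (hy : ∀ i, i ≠ q → y i = y' i) : siteBlock q M x y = siteBlock q M x' y' := by
  have hu : ∀ {z z' : ∀ i, Fin (d i)}, (∀ i, i ≠ q → z i = z' i) → ∀ s,
      Function.update z q s = Function.update z' q s := by
    intro z z' h s
    ext i
    by_cases hi : i = q
    · subst hi; simp
    · simp [hi, h i hi]
  ext s t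
  simp only [siteBlock, Matrix.of_apply, hu hx, hu hy]

lemma siteBlock_apply_self (x y : ∀ i, Fin (d i)) : siteBlock q M x y (x q) (y q) = M x y := by
  simp [siteBlock]

lemma siteBlock_conjTranspose (hM : M.IsHermitian) (x y : ∀ i, Fin (d i)) :
    (siteBlock q M x y)ᴴ = siteBlock q M y x := by
  ext s t
  simp only [siteBlock, Matrix.conjTranspose_apply, Matrix.of_apply]
  exact hM.apply _ _

lemma siteBlock_eq_zero {i : Fin n} (hi : i ≠ q) (h : ActsTriviallyAt M i)
    {x y : ∀ i, Fin (d i)} (hxy : x i ≠ y i) : siteBlock q M x y = 0 := by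
  ext s t
  exact h.apply_eq_zero (by simpa [hi] using hxy)

lemma siteBlock_piecewise (T : Finset (Fin n)) (hq : q ∉ T)
    (hT : ∀ i ∈ T, ActsTriviallyAt M i) {x y : ∀ i, Fin (d i)} (hxy : ∀ i ∈ T, x i = y i)
    (w : ∀ i, Fin (d i)) :
    siteBlock q M (T.piecewise w x) (T.piecewise w y) = siteBlock q M x y := by
  ext s t
  have hne : ∀ i ∈ T, i ≠ q := fun i hi => ne_of_mem_of_not_mem hi hq
  simp only [siteBlock, Matrix.of_apply, T.update_piecewise_of_notMem _ _ hq]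
  exact apply_piecewise_of_actsTriviallyAt T hT (fun i hi => by simp [hne i hi, hxy i hi]) w

lemma sum_eq_sum_update (z : ∀ i, Fin (d i)) (f : (∀ i, Fin (d i)) → ℂ)
    (hf : ∀ w, (∃ i, i ≠ q ∧ w i ≠ z i) → f w = 0) :
    ∑ w, f w = ∑ u, f (Function.update z q u) := by
  symm
  refine Fintype.sum_of_injective (Function.update z q) (Function.update_injective z q) _ _
    (fun w hw => hf w ?_) (fun _ => rfl)
  by_contra! h
  exact hw ⟨w q, (Function.eq_update_iff.mpr ⟨rfl, h⟩).symm⟩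

/-- If the product of blocks of `M₁` and `M₂` passes through a single intermediate configuration
away from `q`, it is a block of the product. -/
lemma siteBlock_mul (x y z : ∀ i, Fin (d i))
    (h : ∀ i, i ≠ q → (ActsTriviallyAt M₁ i ∧ x i = z i) ∨ (ActsTriviallyAt M₂ i ∧ z i = y i)) :
    siteBlock q (M₁ * M₂) x y = siteBlock q M₁ x z * siteBlock q M₂ z y := by
  ext s t
  simp only [siteBlock, Matrix.of_apply, Matrix.mul_apply]
  refine sum_eq_sum_update z _ ?_
  rintro w ⟨i, hi, hw⟩
  rcases h i hi with ⟨h1, h2⟩ | ⟨h1, h2⟩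
  · rw [h1.apply_eq_zero (by simpa [hi, h2] using hw.symm), zero_mul]
  · rw [h1.apply_eq_zero (x := w) (by simpa [hi, ← h2] using hw), mul_zero]

/-- If two commuting operators have supports meeting at most in `q`, then their blocks at `q`
commute. -/
lemma commute_siteBlock (hcomm : Commute M₁ M₂) (hsupp : supp M₁ ∩ supp M₂ ⊆ {q})
    (a b c e : ∀ i, Fin (d i)) : Commute (siteBlock q M₁ a b) (siteBlock q M₂ c e) := by
  classical
  set T : Finset (Fin n) := {i | i ≠ q ∧ ActsTriviallyAt M₁ i} with hTdef
  set U : Finset (Fin n) := {i | i ≠ q ∧ ¬ ActsTriviallyAt M₁ i} with hUdef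
  have hT : ∀ i ∈ T, ActsTriviallyAt M₁ i := fun i hi => by simp_all
  have hU : ∀ i ∈ U, ActsTriviallyAt M₂ i := by
    intro i hi
    by_contra h
    obtain ⟨hiq, hi1⟩ : i ≠ q ∧ ¬ ActsTriviallyAt M₁ i := by simpa [hUdef] using hi
    exact hiq (hsupp ⟨hi1, h⟩)
  have hqT : q ∉ T := by simp [hTdef]
  have hqU : q ∉ U := by simp [hUdef]
  have hTU : ∀ i, i ≠ q → (i ∈ T ∧ i ∉ U) ∨ (i ∉ T ∧ i ∈ U) := by
    intro i hi
    by_cases h : ActsTriviallyAt M₁ i <;> simp [hTdef, hUdef, hi, h]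
  by_cases hab : ∀ i ∈ T, a i = b i
  swap
  · push Not at hab
    obtain ⟨i, hi, hne⟩ := hab
    rw [siteBlock_eq_zero (ne_of_mem_of_not_mem hi hqT) (hT i hi) hne]
    exact Commute.zero_left _
  by_cases hce : ∀ i ∈ U, c i = e i
  swap
  · push Not at hce
    obtain ⟨i, hi, hne⟩ := hce
    rw [siteBlock_eq_zero (ne_of_mem_of_not_mem hi hqU) (hU i hi) hne]
    exact Commute.zero_right _
  have hright : ∀ w, siteBlock q M₂ (T.piecewise c w) (T.piecewise e w) = siteBlock q M₂ c e := by
    intro w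
    rw [← siteBlock_piecewise U hqU hU hce w]
    refine siteBlock_congr ?_ ?_ <;>
    · intro i hi
      rcases hTU i hi with ⟨h1, h2⟩ | ⟨h1, h2⟩ <;> simp [h1, h2]
  have h12 : siteBlock q (M₁ * M₂) (T.piecewise c a) (T.piecewise e b) =
      siteBlock q M₁ a b * siteBlock q M₂ c e := by
    rw [siteBlock_mul _ _ (T.piecewise c b), siteBlock_piecewise T hqT hT hab, hright]
    intro i hi
    rcases hTU i hi with ⟨h1, h2⟩ | ⟨h1, h2⟩
    · exact Or.inl ⟨hT i h1, by simp [h1]⟩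
    · exact Or.inr ⟨hU i h2, by simp [h1]⟩
  have h21 : siteBlock q (M₂ * M₁) (T.piecewise c a) (T.piecewise e b) =
      siteBlock q M₂ c e * siteBlock q M₁ a b := by
    rw [siteBlock_mul _ _ (T.piecewise e a), siteBlock_piecewise T hqT hT hab, hright]
    intro i hi
    rcases hTU i hi with ⟨h1, h2⟩ | ⟨h1, h2⟩
    · exact Or.inr ⟨hT i h1, by simp [h1]⟩
    · exact Or.inl ⟨hU i h2, by simp [h1]⟩
  rw [commute_iff_eq, ← h12, ← h21, hcomm.eq]

lemma actsTriviallyAt_of_siteBlock_scalar (s₀ : Fin (d q))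
    (h : ∀ x y, ∃ c : ℂ, siteBlock q M x y = c • 1) : ActsTriviallyAt M q := by
  choose c hc using h
  let ext : (∀ j : {j : Fin n // j ≠ q}, Fin (d j.1)) → ∀ i, Fin (d i) :=
    fun a i => if hi : i = q then hi ▸ s₀ else a ⟨i, hi⟩
  have hext : ∀ (x : ∀ i, Fin (d i)) i, i ≠ q → x i = ext (fun j => x j.1) i := by
    intro x i hi
    simp [ext, hi]
  refine ⟨fun a b => c (ext a) (ext b), fun x y => ?_⟩
  rw [← siteBlock_apply_self (q := q) (M := M) x y, siteBlock_congr (hext x) (hext y), hc]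
  simp [Matrix.one_apply]

lemma ActsTriviallyAt.siteBlock_scalar (h : ActsTriviallyAt M q) (x y : ∀ i, Fin (d i)) :
    ∃ c : ℂ, siteBlock q M x y = c • 1 := by
  refine ⟨siteBlock q M x y (x q) (x q), ?_⟩
  ext s t
  by_cases hst : s = t
  · subst hst
    have h1 := h.apply_update (x := Function.update x q (x q)) (y := Function.update y q (x q))
      (by simp) s
    rw [Function.update_idem, Function.update_idem] at h1
    simpa [siteBlock] using h1
  · simpa [hst, siteBlock] using
      h.apply_eq_zero (x := Function.update x q s) (y := Function.update y q t) (by simpa using hst)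

lemma exists_siteBlock_nonscalar (s₀ : Fin (d q)) (h : q ∈ supp M) :
    ∃ x y, ∀ c : ℂ, siteBlock q M x y ≠ c • 1 := by
  by_contra! hcon
  exact h (actsTriviallyAt_of_siteBlock_scalar s₀ hcon)

lemma commute_projAt (v : Fin (d q) → ℂ)
    (h : ∀ x y, Commute (siteBlock q M x y) (Matrix.vecMulVec v (star v))) :
    Commute M (projAt q v) := by
  rw [commute_iff_eq]
  ext x y
  have hxy := congrFun (congrFun (h x y).eq (x q)) (y q)
  simp only [Matrix.mul_apply, siteBlock, Matrix.of_apply, Matrix.vecMulVec_apply,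
    Function.update_eq_self, Pi.star_apply] at hxy
  have hproj : ∀ w z : ∀ i, Fin (d i), (∃ i, i ≠ q ∧ w i ≠ z i) → projAt q v w z = 0 := by
    rintro w z ⟨i, hi, hne⟩
    refine if_neg fun heq => hne ?_
    rw [← heq, Function.update_of_ne hi]
  rw [Matrix.mul_apply, Matrix.mul_apply,
    sum_eq_sum_update (q := q) y _ (fun w hw => by rw [hproj w y hw, mul_zero]),
    sum_eq_sum_update (q := q) x _ (fun w hw => by
      obtain ⟨i, hi, hne⟩ := hw
      rw [hproj x w ⟨i, hi, hne.symm⟩, zero_mul])]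
  simpa [projAt] using hxy

end Sites

/-- Corollary 4.9.  Let `S` be a finite set of pairwise commuting
self-adjoint operators on `H_1 ⊗ ⋯ ⊗ H_n` and let `q` be a particle with `dim H_q = 2`.
If the set of elements of `S` acting nontrivially on `q` admits a partition into two
disjoint nonempty sets `Sleft` and `Sright` such that the supports of any `H_i ∈ Sleft`
and `H_j ∈ Sright` intersect inside `{q}`, then `q` is separable for `S`. -/
theorem left_right_partition_implies_separable
    {n : ℕ} {d : Fin n → ℕ} (q : Fin n) (hq : d q = 2)
    (S Sleft Sright : Finset (Matrix (∀ i, Fin (d i)) (∀ i, Fin (d i)) ℂ))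
    (hsa : ∀ H ∈ S, H.IsHermitian)
    (hcomm : ∀ H ∈ S, ∀ H' ∈ S, Commute H H')
    (hcover : ∀ H, (H ∈ Sleft ∨ H ∈ Sright) ↔ (H ∈ S ∧ q ∈ supp H))
    (hdisj : Disjoint Sleft Sright)
    (hlne : Sleft.Nonempty) (hrne : Sright.Nonempty)
    (hint : ∀ H₁ ∈ Sleft, ∀ H₂ ∈ Sright, supp H₁ ∩ supp H₂ ⊆ {q}) :
    SeparableAt S q := by
  have s₀ : Fin (d q) := ⟨0, by omega⟩
  have hl : ∀ H ∈ Sleft, H ∈ S ∧ q ∈ supp H := fun H hH => (hcover H).mp (Or.inl hH)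
  have hr : ∀ H ∈ Sright, H ∈ S ∧ q ∈ supp H := fun H hH => (hcover H).mp (Or.inr hH)
  obtain ⟨v₀, v₁, h0, h1, h01, hv⟩ := exists_orthonormal_commute hq
    (L := {A | ∃ H ∈ Sleft, ∃ x y, siteBlock q H x y = A})
    (R := {A | ∃ H ∈ Sright, ∃ x y, siteBlock q H x y = A})
    (by
      rintro _ ⟨H₁, hH₁, a, b, rfl⟩ _ ⟨H₂, hH₂, c, e, rfl⟩
      exact commute_siteBlock (hcomm H₁ (hl H₁ hH₁).1 H₂ (hr H₂ hH₂).1) (hint H₁ hH₁ H₂ hH₂)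
        a b c e)
    (by
      obtain ⟨H, hH⟩ := hlne
      obtain ⟨x, y, hxy⟩ := exists_siteBlock_nonscalar s₀ (hl H hH).2
      exact ⟨_, ⟨H, hH, x, y, rfl⟩, hxy⟩)
    (by
      obtain ⟨H, hH⟩ := hrne
      obtain ⟨x, y, hxy⟩ := exists_siteBlock_nonscalar s₀ (hr H hH).2
      exact ⟨_, ⟨H, hH, x, y, rfl⟩, hxy⟩)
    (by
      rintro _ ⟨H, hH, x, y, rfl⟩
      exact ⟨H, hH, y, x, (siteBlock_conjTranspose (hsa H (hr H hH).1) x y).symm⟩)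
  refine ⟨v₀, v₁, h0, h1, h01, fun H hH => commute_projAt v₀ fun x y => ?_⟩
  by_cases hqH : q ∈ supp H
  · rcases (hcover H).mpr ⟨hH, hqH⟩ with h | h
    · exact hv _ (Or.inl ⟨H, h, x, y, rfl⟩)
    · exact hv _ (Or.inr ⟨H, h, x, y, rfl⟩)
  · obtain ⟨c, hc⟩ := (not_not.mp hqH : ActsTriviallyAt H q).siteBlock_scalar x y
    rw [hc]
    exact (Commute.one_left _).smul_left c
end

section
/- Let V be a 3-dimensional complex Hilbert space and E a finite-dimensional complex Hilbert space, and let H be a self-adjoint operator on V ⊗ E that possesses at least one critical subspace on V. Suppose H preserves two one-dimensional subspaces S₀ and S₁ of V that are neither equal nor orthogonal to each other. Then S_c = (S₀ + S₁)^⊥, the orthogonal complement in V of the span of S₀ and S₁, is a critical subspace of H on V. (Fact 5.8.) -/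
open Matrix Kronecker

/-- The `(k,l)` slice of an operator `H` on `V ⊗ W`: the operator `A` on `V` with
`A i j = H (i,k) (j,l)`.  Expanding `H` in the (linearly independent) standard matrix basis
of `End(W)`, these slices are precisely the `V`-side coefficients. -/
def sliceMat {dV : ℕ} {W : Type} (H : Matrix (Fin dV × W) (Fin dV × W) ℂ) (k l : W) :
    Matrix (Fin dV) (Fin dV) ℂ :=
  Matrix.of fun i j => H (i, k) (j, l)

/-- The algebra induced by `H` on `V`: the unital subalgebra of `End(V)` generated by the
coefficients of (any, equivalently this canonical) decomposition `H = Σ A_α ⊗ B_α` with the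
`B_α` linearly independent. -/
def inducedAlg {dV : ℕ} {W : Type} (H : Matrix (Fin dV × W) (Fin dV × W) ℂ) :
    Subalgebra ℂ (Matrix (Fin dV) (Fin dV) ℂ) :=
  Algebra.adjoin ℂ {A | ∃ k l : W, A = sliceMat H k l}

/-- The orthogonal projection onto the line `ℂv`, for a unit vector `v`. -/
def projMat {m : ℕ} (v : Fin m → ℂ) : Matrix (Fin m) (Fin m) ℂ :=
  vecMulVec v (star v)

/-- The one-dimensional subspace `ℂv` (given by a unit vector `v`) is a critical subspace of
`H` on `V`: the orthogonal projection onto it lies in the center of the algebra induced by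
`H` on `V`. -/
def IsCriticalLine {dV : ℕ} {W : Type} (H : Matrix (Fin dV × W) (Fin dV × W) ℂ)
    (v : Fin dV → ℂ) : Prop :=
  star v ⬝ᵥ v = 1 ∧ projMat v ∈ inducedAlg H ∧
    ∀ X ∈ inducedAlg H, Commute (projMat v) X

/-- `H` preserves the subspace `ℂv ⊗ W` of `V ⊗ W`. -/
def PreservesLine {dV : ℕ} {W : Type} [Fintype W] [DecidableEq W]
    (H : Matrix (Fin dV × W) (Fin dV × W) ℂ) (v : Fin dV → ℂ) : Prop :=
  ((projMat v) ⊗ₖ (1 : Matrix W W ℂ)) * (H * ((projMat v) ⊗ₖ (1 : Matrix W W ℂ))) =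
    H * ((projMat v) ⊗ₖ (1 : Matrix W W ℂ))

/-- The operator `M ⊗ I_{E₂}` on `H_q ⊗ E₁ ⊗ E₂`, for `M` an operator on `H_q ⊗ E₁`. -/
def liftL {dq e₁ e₂ : ℕ} (M : Matrix (Fin dq × Fin e₁) (Fin dq × Fin e₁) ℂ) :
    Matrix (Fin dq × Fin e₁ × Fin e₂) (Fin dq × Fin e₁ × Fin e₂) ℂ :=
  Matrix.of fun p q =>
    M (p.1, p.2.1) (q.1, q.2.1) * (if p.2.2 = q.2.2 then 1 else 0)

/-- The operator on `H_q ⊗ E₁ ⊗ E₂` corresponding, under the canonical permutation of tensor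
factors, to `M ⊗ I_{E₁}` for `M` an operator on `H_q ⊗ E₂`. -/
def liftR {dq e₁ e₂ : ℕ} (M : Matrix (Fin dq × Fin e₂) (Fin dq × Fin e₂) ℂ) :
    Matrix (Fin dq × Fin e₁ × Fin e₂) (Fin dq × Fin e₁ × Fin e₂) ℂ :=
  Matrix.of fun p q =>
    M (p.1, p.2.2) (q.1, q.2.2) * (if p.2.1 = q.2.1 then 1 else 0)

/-- An operator on `H_q ⊗ E` acts trivially on the first tensor factor `H_q` if it can be
written as `I_{H_q} ⊗ B` for some operator `B` on `E`. -/
def ActsTrivFst {dq : ℕ} {β : Type} (M : Matrix (Fin dq × β) (Fin dq × β) ℂ) : Prop :=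
  ∃ B : Matrix β β ℂ, ∀ p q, M p q = (if p.1 = q.1 then (1 : ℂ) else 0) * B p.2 q.2

theorem projMat_mulVec {m : ℕ} (v x : Fin m → ℂ) :
    projMat v *ᵥ x = (star v ⬝ᵥ x) • v := by
  simp [projMat, vecMulVec_mulVec]

theorem vecMul_projMat {m : ℕ} (v x : Fin m → ℂ) :
    x ᵥ* projMat v = (x ⬝ᵥ v) • star v := by
  simp [projMat, vecMul_vecMulVec]

theorem conjTranspose_projMat {m : ℕ} (v : Fin m → ℂ) : (projMat v)ᴴ = projMat v := by
  simp [projMat, conjTranspose_vecMulVec]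

theorem sliceMat_kronecker_one_mul {d : ℕ} {W : Type} [Fintype W] [DecidableEq W]
    (P : Matrix (Fin d) (Fin d) ℂ) (H : Matrix (Fin d × W) (Fin d × W) ℂ) (k l : W) :
    sliceMat ((P ⊗ₖ (1 : Matrix W W ℂ)) * H) k l = P * sliceMat H k l := by
  ext i j
  simp [sliceMat, Matrix.mul_apply, Fintype.sum_prod_type, Matrix.one_apply]

theorem sliceMat_mul_kronecker_one {d : ℕ} {W : Type} [Fintype W] [DecidableEq W]
    (P : Matrix (Fin d) (Fin d) ℂ) (H : Matrix (Fin d × W) (Fin d × W) ℂ) (k l : W) :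
    sliceMat (H * (P ⊗ₖ (1 : Matrix W W ℂ))) k l = sliceMat H k l * P := by
  ext i j
  simp [sliceMat, Matrix.mul_apply, Fintype.sum_prod_type, Matrix.one_apply]

theorem conjTranspose_sliceMat {d : ℕ} {W : Type}
    {H : Matrix (Fin d × W) (Fin d × W) ℂ} (hH : H.IsHermitian) (k l : W) :
    (sliceMat H k l)ᴴ = sliceMat H l k := by
  ext i j
  simpa [sliceMat] using hH.apply (i, l) (j, k)

theorem PreservesLine.projMat_mul_sliceMat_mul {d : ℕ} {W : Type} [Fintype W] [DecidableEq W]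
    {H : Matrix (Fin d × W) (Fin d × W) ℂ} {v : Fin d → ℂ} (h : PreservesLine H v) (k l : W) :
    projMat v * (sliceMat H k l * projMat v) = sliceMat H k l * projMat v := by
  have := congrArg (fun M => sliceMat M k l) h
  simpa only [sliceMat_kronecker_one_mul, sliceMat_mul_kronecker_one] using this

/-- The slices of a self-adjoint operator commute with the projection onto a preserved line. -/
theorem PreservesLine.commute_sliceMat {d : ℕ} {W : Type} [Fintype W] [DecidableEq W]
    {H : Matrix (Fin d × W) (Fin d × W) ℂ} (hH : H.IsHermitian) {v : Fin d → ℂ}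
    (h : PreservesLine H v) (k l : W) : Commute (projMat v) (sliceMat H k l) := by
  have h₁ := h.projMat_mul_sliceMat_mul k l
  have h₂ := congrArg conjTranspose (h.projMat_mul_sliceMat_mul l k)
  simp only [conjTranspose_mul, conjTranspose_projMat, conjTranspose_sliceMat hH,
    Matrix.mul_assoc] at h₂
  exact h₂.symm.trans h₁

theorem exists_eigenvalue_of_commute_projMat {m : ℕ} {v : Fin m → ℂ} (hv : star v ⬝ᵥ v = 1)
    {A : Matrix (Fin m) (Fin m) ℂ} (h : Commute (projMat v) A) :
    ∃ a : ℂ, A *ᵥ v = a • v ∧ star v ᵥ* A = a • star v := by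
  refine ⟨star v ⬝ᵥ A *ᵥ v, ?_, ?_⟩
  · have := congrArg (· *ᵥ v) h.eq
    simpa [← mulVec_mulVec, projMat_mulVec, hv, mulVec_smul] using this.symm
  · have := congrArg (star v ᵥ* ·) h.eq
    simpa [← vecMul_vecMul, vecMul_projMat, hv, smul_vecMul, dotProduct_mulVec] using this

theorem linearIndependent_of_orthogonal {v₀ v₁ w : Fin 3 → ℂ}
    (hv₀ : star v₀ ⬝ᵥ v₀ = 1) (hneq : ¬ ∃ c : ℂ, v₁ = c • v₀)
    (hw : star w ⬝ᵥ w = 1) (h₀ : star w ⬝ᵥ v₀ = 0) (h₁ : star w ⬝ᵥ v₁ = 0) :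
    LinearIndependent ℂ ![v₀, v₁, w] := by
  rw [Fintype.linearIndependent_iff]
  intro g hg
  simp only [Fin.sum_univ_three, cons_val_zero, cons_val_one, cons_val] at hg
  have g2 : g 2 = 0 := by
    have := congrArg (star w ⬝ᵥ ·) hg
    simpa [dotProduct_add, h₀, h₁, hw] using this
  have g1 : g 1 = 0 := by
    by_contra hne
    refine hneq ⟨-((g 1)⁻¹ * g 0), ?_⟩
    have hg' : g 1 • v₁ = -(g 0 • v₀) := by
      rw [g2, zero_smul, add_zero] at hg
      exact eq_neg_of_add_eq_zero_right hg
    rw [neg_smul, mul_smul, ← smul_neg, ← hg', smul_smul, inv_mul_cancel₀ hne, one_smul]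
  have g0 : g 0 = 0 := by
    have := congrArg (star v₀ ⬝ᵥ ·) hg
    simpa [g1, g2, hv₀] using this
  intro i
  fin_cases i <;> assumption

/-- A matrix whose sesquilinear form vanishes on all pairs from a basis is zero. -/
theorem eq_zero_of_dotProduct_mulVec_eq_zero {m : ℕ} {b : Fin m → Fin m → ℂ}
    (hb : LinearIndependent ℂ b) {C : Matrix (Fin m) (Fin m) ℂ}
    (h : ∀ i j, star (b i) ⬝ᵥ C *ᵥ b j = 0) : C = 0 := by
  have hu : IsUnit (Matrix.of b) := linearIndependent_rows_iff_isUnit.mp hb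
  have hT : IsUnit (Matrix.of b)ᵀ := (isUnit_transpose _).mpr hu
  have hS : IsUnit ((Matrix.of b)ᵀ)ᴴ := hT.star
  have hz : ((Matrix.of b)ᵀ)ᴴ * (C * (Matrix.of b)ᵀ) = 0 := by
    ext i j
    exact h i j
  rwa [hS.mul_right_eq_zero, hT.mul_left_eq_zero] at hz

/-- A matrix commuting with the projections onto two distinct nonorthogonal lines in `ℂ³` is a
combination of the identity and the projection onto the common orthogonal line. -/
theorem exists_eq_smul_one_add_smul_projMat {v₀ v₁ w : Fin 3 → ℂ}
    (hv₀ : star v₀ ⬝ᵥ v₀ = 1) (hv₁ : star v₁ ⬝ᵥ v₁ = 1)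
    (hneq : ¬ ∃ c : ℂ, v₁ = c • v₀) (hnorth : star v₀ ⬝ᵥ v₁ ≠ 0)
    (hw : star w ⬝ᵥ w = 1) (h₀ : star v₀ ⬝ᵥ w = 0) (h₁ : star v₁ ⬝ᵥ w = 0)
    {A : Matrix (Fin 3) (Fin 3) ℂ}
    (hA₀ : Commute (projMat v₀) A) (hA₁ : Commute (projMat v₁) A) :
    ∃ a d : ℂ, A = a • 1 + d • projMat w := by
  obtain ⟨a, har, hal⟩ := exists_eigenvalue_of_commute_projMat hv₀ hA₀
  obtain ⟨b, hbr, hbl⟩ := exists_eigenvalue_of_commute_projMat hv₁ hA₁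
  have hab : a = b := by
    have : (star v₀ ᵥ* A) ⬝ᵥ v₁ = star v₀ ⬝ᵥ A *ᵥ v₁ := (dotProduct_mulVec _ _ _).symm
    rw [hal, hbr, smul_dotProduct, dotProduct_smul] at this
    exact mul_right_cancel₀ hnorth this
  subst hab
  have h₀' : star w ⬝ᵥ v₀ = 0 := by
    rw [star_dotProduct, h₀, star_zero]
  have h₁' : star w ⬝ᵥ v₁ = 0 := by
    rw [star_dotProduct, h₁, star_zero]
  refine ⟨a, star w ⬝ᵥ A *ᵥ w - a, ?_⟩
  rw [← sub_eq_zero]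
  refine eq_zero_of_dotProduct_mulVec_eq_zero
    (linearIndependent_of_orthogonal hv₀ hneq hw h₀' h₁') fun i j => ?_
  have e₀ (x : Fin 3 → ℂ) : star v₀ ⬝ᵥ A *ᵥ x = a * (star v₀ ⬝ᵥ x) := by
    rw [dotProduct_mulVec, hal, smul_dotProduct, smul_eq_mul]
  have e₁ (x : Fin 3 → ℂ) : star v₁ ⬝ᵥ A *ᵥ x = a * (star v₁ ⬝ᵥ x) := by
    rw [dotProduct_mulVec, hbl, smul_dotProduct, smul_eq_mul]
  fin_cases i <;> fin_cases j <;>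
    simp [sub_mulVec, add_mulVec, smul_mulVec, dotProduct_sub, dotProduct_add, projMat_mulVec,
      e₀, e₁, har, hbr, h₀, h₁, h₀', h₁', hw]

theorem projMat_ne_smul_one {u : Fin 3 → ℂ} (hu : star u ⬝ᵥ u = 1) (a : ℂ) :
    projMat u ≠ a • 1 := by
  intro h
  have htr : (1 : ℂ) = a * 3 := by
    have := congrArg trace h
    simpa [projMat, trace_vecMulVec, dotProduct_comm u, hu] using this
  have hid : a • u = u := by
    have := congrArg (· *ᵥ u) h
    simpa [projMat_mulVec, hu, smul_mulVec] using this.symm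
  have ha : a = 1 := by
    have := congrArg (star u ⬝ᵥ ·) hid
    simpa [hu] using this
  norm_num [ha] at htr

/-- Fact 5.8.  Let `V` be 3-dimensional, `E` finite-dimensional, and `H`
a self-adjoint operator on `V ⊗ E` possessing at least one critical subspace on `V`.  If `H`
preserves two one-dimensional subspaces `S₀ = ℂv₀` and `S₁ = ℂv₁` of `V` that are neither
equal nor orthogonal, then the orthogonal complement of their span (spanned by any unit
vector `w` orthogonal to both `v₀` and `v₁`) is a critical subspace of `H` on `V`. -/
theorem orthocomplement_is_critical
    {e : ℕ} (H : Matrix (Fin 3 × Fin e) (Fin 3 × Fin e) ℂ)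
    (hsa : H.IsHermitian)
    (hcrit : ∃ u : Fin 3 → ℂ, IsCriticalLine H u)
    (v₀ v₁ : Fin 3 → ℂ)
    (hv₀ : star v₀ ⬝ᵥ v₀ = 1) (hv₁ : star v₁ ⬝ᵥ v₁ = 1)
    (hneq : ¬ ∃ c : ℂ, v₁ = c • v₀)
    (hnorth : star v₀ ⬝ᵥ v₁ ≠ 0)
    (hp₀ : PreservesLine H v₀) (hp₁ : PreservesLine H v₁) :
    ∀ w : Fin 3 → ℂ, star w ⬝ᵥ w = 1 → star v₀ ⬝ᵥ w = 0 → star v₁ ⬝ᵥ w = 0 →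
      IsCriticalLine H w := by
  intro w hw h₀ h₁
  have hform : ∀ X ∈ inducedAlg H, ∃ a d : ℂ, X = a • 1 + d • projMat w := by
    intro X hX
    have hcomm (v : Fin 3 → ℂ) (hp : PreservesLine H v) : Commute (projMat v) X := by
      have hle : inducedAlg H ≤ Subalgebra.centralizer ℂ {projMat v} := by
        refine Algebra.adjoin_le ?_
        rintro _ ⟨k, l, rfl⟩
        rintro _ rfl
        exact (hp.commute_sliceMat hsa k l).eq
      exact Subalgebra.mem_centralizer_iff ℂ |>.mp (hle hX) _ rfl
    exact exists_eq_smul_one_add_smul_projMat hv₀ hv₁ hneq hnorth hw h₀ h₁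
      (hcomm v₀ hp₀) (hcomm v₁ hp₁)
  refine ⟨hw, ?_, fun X hX => ?_⟩
  · obtain ⟨u, hu, hmem, -⟩ := hcrit
    obtain ⟨a, d, had⟩ := hform _ hmem
    have hd : d ≠ 0 := by
      rintro rfl
      exact projMat_ne_smul_one hu a (by simpa using had)
    have hPw : projMat w = d⁻¹ • (projMat u - a • 1) := by
      rw [had, add_sub_cancel_left, smul_smul, inv_mul_cancel₀ hd, one_smul]
    rw [hPw]
    exact Subalgebra.smul_mem _ (sub_mem hmem (Subalgebra.smul_mem _ (one_mem _) a)) _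
  · obtain ⟨a, d, rfl⟩ := hform X hX
    exact ((Commute.one_right _).smul_right a).add_right ((Commute.refl _).smul_right d)
end
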